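/- Let Ẑ ~ ∑_{i=1}^k π_i N(μ_i, Σ_i), let ε ~ N(0, Σ_p) be independent with Σ_p positive definite, and Z = Ẑ + ε. Then the mutual information satisfies I(Z; Ẑ) ≤ ∑_{i=1}^k π_i ( -log π_i + (1/2) log( det(Σ_i + Σ_p) / det(Σ_p) ) ). -/

import Mathlib

open MeasureTheory Real Matrix Finset

/-- The multivariate Gaussian density `N(m, S)` on `ℝ^d` (for `S` positive definite). -/
noncomputable def gaussianDensity {d : ℕ} (m : EuclideanSpace ℝ (Fin d))
    (S : Matrix (Fin d) (Fin d) ℝ) (x : EuclideanSpace ℝ (Fin d)) : ℝ :=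
  (Real.sqrt ((2 * π) ^ d * S.det))⁻¹ *
    Real.exp (-(1 / 2) * dotProduct (fun i => x i - m i) (S⁻¹ *ᵥ fun i => x i - m i))

/-- Differential entropy of a density on `ℝ^d`. -/
noncomputable def diffEntropy {d : ℕ} (p : EuclideanSpace ℝ (Fin d) → ℝ) : ℝ :=
  -∫ x, p x * Real.log (p x)

lemma aux_int1 : Integrable (fun x : ℝ => Real.exp (-(1/2) * x^2)) := by
  simpa using integrable_exp_neg_mul_sq (b := 1/2) (by norm_num)

lemma aux_int2 : Integrable (fun x : ℝ => x^2 * Real.exp (-(1/2) * x^2)) := by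
  have := integrable_rpow_mul_exp_neg_mul_sq (b := 1/2) (by norm_num) (s := 2) (by norm_num)
  simpa using this

lemma aux_val1 : ∫ x : ℝ, Real.exp (-(1/2) * x^2) = √(2 * π) := by
  rw [integral_gaussian]; congr 1; ring

lemma aux_val2 : ∫ x : ℝ, x^2 * Real.exp (-(1/2) * x^2) = √(2 * π) := by
  have h := ProbabilityTheory.variance_id_gaussianReal (μ := 0) (v := 1)
  rw [ProbabilityTheory.variance_eq_integral (by fun_prop)] at h
  simp only [id, ProbabilityTheory.integral_id_gaussianReal, sub_zero] at h
  rw [ProbabilityTheory.integral_gaussianReal_eq_integral_smul (by norm_num)] at h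
  simp only [ProbabilityTheory.gaussianPDFReal, smul_eq_mul, sub_zero, NNReal.coe_one, mul_one] at h
  simp_rw [mul_assoc] at h
  rw [integral_const_mul] at h
  have hp : √(2 * π) ≠ 0 := by positivity
  have h2 : ∫ x : ℝ, x^2 * Real.exp (-(1/2) * x^2) = ∫ x : ℝ, x^2 * Real.exp (-(x^2 / 2)) := by
    congr 1; ext x; congr 2; ring
  rw [h2]
  field_simp at h
  simpa using h

lemma aux_G {d : ℕ} (x : Fin d → ℝ) :
    Real.exp (-(1/2) * (x ⬝ᵥ x)) = ∏ j, Real.exp (-(1/2) * (x j)^2) := by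
  rw [← Real.exp_sum, dotProduct, Finset.mul_sum]
  congr 1; apply Finset.sum_congr rfl; intros; ring

lemma aux_int3 (d : ℕ) : Integrable (fun x : Fin d → ℝ => Real.exp (-(1/2) * (x ⬝ᵥ x))) := by
  simp_rw [aux_G]
  exact Integrable.fintype_prod (f := fun _ (v : ℝ) => Real.exp (-(1/2) * v^2)) (fun _ => aux_int1)

lemma aux_val3 (d : ℕ) : ∫ x : Fin d → ℝ, Real.exp (-(1/2) * (x ⬝ᵥ x)) = √(2 * π) ^ d := by
  simp_rw [aux_G]
  rw [integral_fintype_prod_volume_eq_prod (f := fun _ (v : ℝ) => Real.exp (-(1/2) * v^2))]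
  simp only [aux_val1]; simp

lemma aux_coord {d : ℕ} (i : Fin d) (x : Fin d → ℝ) :
    (x i)^2 * Real.exp (-(1/2) * (x ⬝ᵥ x)) =
      ∏ j, (if j = i then (x j)^2 * Real.exp (-(1/2) * (x j)^2)
        else Real.exp (-(1/2) * (x j)^2)) := by
  rw [aux_G, ← Finset.mul_prod_erase _ _ (Finset.mem_univ i),
    ← Finset.mul_prod_erase (a := i) _ (fun j => if j = i then _ else _) (Finset.mem_univ i)]
  rw [if_pos rfl, mul_assoc]
  congr 2
  apply Finset.prod_congr rfl
  intro j hj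
  rw [if_neg (Finset.ne_of_mem_erase hj)]

lemma aux_int4 {d : ℕ} (i : Fin d) :
    Integrable (fun x : Fin d → ℝ => (x i)^2 * Real.exp (-(1/2) * (x ⬝ᵥ x))) := by
  simp_rw [aux_coord]
  refine Integrable.fintype_prod (f := fun j (v : ℝ) => if j = i then v^2 * Real.exp (-(1/2) * v^2)
    else Real.exp (-(1/2) * v^2)) (fun j => ?_)
  by_cases h : j = i
  · simpa only [if_pos h] using aux_int2
  · simpa only [if_neg h] using aux_int1

lemma aux_val4 {d : ℕ} (i : Fin d) :
    ∫ x : Fin d → ℝ, (x i)^2 * Real.exp (-(1/2) * (x ⬝ᵥ x)) = √(2 * π) ^ d := by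
  simp_rw [aux_coord]
  rw [integral_fintype_prod_volume_eq_prod (f := fun j (v : ℝ) =>
    if j = i then v^2 * Real.exp (-(1/2) * v^2) else Real.exp (-(1/2) * v^2))]
  have : ∀ j : Fin d, (∫ v : ℝ, if j = i then v^2 * Real.exp (-(1/2) * v^2)
    else Real.exp (-(1/2) * v^2)) = √(2 * π) := by
    intro j
    by_cases h : j = i
    · simp only [if_pos h]; exact aux_val2
    · simp only [if_neg h]; exact aux_val1
  simp only [this]; simp

lemma aux_dot {d : ℕ} (x : Fin d → ℝ) : (x ⬝ᵥ x) * Real.exp (-(1/2) * (x ⬝ᵥ x))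
    = ∑ i, (x i)^2 * Real.exp (-(1/2) * (x ⬝ᵥ x)) := by
  rw [← Finset.sum_mul]; congr 1
  simp [dotProduct, sq]

lemma aux_int5 (d : ℕ) :
    Integrable (fun x : Fin d → ℝ => (x ⬝ᵥ x) * Real.exp (-(1/2) * (x ⬝ᵥ x))) := by
  rw [funext aux_dot]
  exact integrable_finsetSum _ (fun i _ => aux_int4 i)

lemma aux_val5 (d : ℕ) :
    ∫ x : Fin d → ℝ, (x ⬝ᵥ x) * Real.exp (-(1/2) * (x ⬝ᵥ x)) = d * √(2 * π) ^ d := by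
  rw [funext aux_dot, integral_finsetSum _ (fun i _ => aux_int4 i)]
  simp only [aux_val4]; simp

lemma aux_cov {d : ℕ} (M : Matrix (Fin d) (Fin d) ℝ) (hM : M.det ≠ 0)
    (m : EuclideanSpace ℝ (Fin d)) (F : (Fin d → ℝ) → ℝ) (hF : Continuous F)
    (hi : Integrable F) :
    Integrable (fun x : EuclideanSpace ℝ (Fin d) => F (M *ᵥ fun i => x i - m i)) ∧
    ∫ x : EuclideanSpace ℝ (Fin d), F (M *ᵥ fun i => x i - m i) = |M.det|⁻¹ * ∫ x, F x := by
  have hmap := Real.map_matrix_volume_pi_eq_smul_volume_pi hM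
  have hc : Measurable (toLin' M : (Fin d → ℝ) → (Fin d → ℝ)) :=
    (LinearMap.continuous_on_pi _).measurable
  have hi1 : Integrable F (Measure.map (toLin' M) volume) := by
    rw [hmap]; exact hi.smul_measure ENNReal.ofReal_ne_top
  have hi2 : Integrable (fun y : Fin d → ℝ => F (M *ᵥ y)) :=
    (integrable_map_measure hF.aestronglyMeasurable hc.aemeasurable).1 hi1
  have hv : ∫ y : Fin d → ℝ, F (M *ᵥ y) = |M.det|⁻¹ * ∫ x, F x := by
    have := integral_map hc.aemeasurable (μ := volume) (f := F) hF.aestronglyMeasurable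
    rw [hmap, integral_smul_measure, ENNReal.toReal_ofReal (abs_nonneg _), abs_inv] at this
    simpa using this.symm
  have hi3 : Integrable (fun y : Fin d → ℝ => F (M *ᵥ fun i => y i - m i)) :=
    hi2.comp_sub_right (fun i => m i)
  have hv3 : ∫ y : Fin d → ℝ, F (M *ᵥ fun i => y i - m i) = |M.det|⁻¹ * ∫ x, F x := by
    rw [← hv]
    exact integral_sub_right_eq_self (fun y : Fin d → ℝ => F (M *ᵥ y)) (fun i => m i)
  have hp := PiLp.volume_preserving_ofLp (Fin d)
  have he := (MeasurableEquiv.toLp 2 (Fin d → ℝ)).symm.measurableEmbedding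
  exact ⟨(hp.integrable_comp_emb he).2 hi3, (hp.integral_comp he
    (fun y : Fin d → ℝ => F (M *ᵥ fun i => y i - m i))).trans hv3⟩

section
open scoped MatrixOrder Matrix.Norms.L2Operator
lemma aux_fac {d : ℕ} (T : Matrix (Fin d) (Fin d) ℝ) (hT : T.PosDef) :
    ∃ M : Matrix (Fin d) (Fin d) ℝ, M.det ≠ 0 ∧ T⁻¹ = Mᵀ * M := by
  obtain ⟨y, hy, h⟩ := CStarAlgebra.isStrictlyPositive_iff_eq_star_mul_self.mp
        hT.inv.isStrictlyPositive
  refine ⟨y, ((Matrix.isUnit_iff_isUnit_det y).1 hy).ne_zero, ?_⟩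
  rw [h, star_eq_conjTranspose, conjTranspose_eq_transpose_of_trivial]
end

lemma aux_main {d : ℕ} (m : EuclideanSpace ℝ (Fin d)) (T : Matrix (Fin d) (Fin d) ℝ)
    (hT : T.PosDef) :
    Integrable (gaussianDensity m T) ∧ (∫ x, gaussianDensity m T x = 1) ∧
    Integrable (fun x => gaussianDensity m T x * Real.log (gaussianDensity m T x)) ∧
    (∫ x, gaussianDensity m T x * Real.log (gaussianDensity m T x)
      = -((1/2) * Real.log ((2 * π * Real.exp 1) ^ d * T.det))) ∧
    (∀ x, 0 < gaussianDensity m T x) ∧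
    (∀ x, gaussianDensity m T x ≤ (Real.sqrt ((2 * π) ^ d * T.det))⁻¹) := by
  obtain ⟨M, hM, hTM⟩ := aux_fac T hT
  have hdet : 0 < T.det := hT.det_pos
  have hdM : |M.det|⁻¹ = √ T.det := by
    have h1 : T.det⁻¹ = M.det ^ 2 := by
      have := congrArg Matrix.det hTM
      rw [Matrix.det_nonsing_inv, Ring.inverse_eq_inv', det_mul, det_transpose] at this
      rw [this, sq]
    rw [← Real.sqrt_sq_eq_abs, ← h1, Real.sqrt_inv, inv_inv]
  set c : ℝ := (Real.sqrt ((2 * π) ^ d * T.det))⁻¹ with hc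
  have hcpos : 0 < c := by positivity
  have hcc : c * (√T.det * √(2 * π) ^ d) = 1 := by
    have : Real.sqrt ((2 * π) ^ d * T.det) = √T.det * √(2 * π) ^ d := by
      rw [Real.sqrt_mul (by positivity), mul_comm]
      congr 1
      rw [Real.sqrt_eq_iff_mul_self_eq (by positivity) (by positivity), ← mul_pow,
        Real.mul_self_sqrt (by positivity)]
    rw [hc, this]
    exact inv_mul_cancel₀ (by positivity)
  have hq : ∀ v : Fin d → ℝ, v ⬝ᵥ (T⁻¹ *ᵥ v) = (M *ᵥ v) ⬝ᵥ (M *ᵥ v) := by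
    intro v
    rw [hTM, ← Matrix.mulVec_mulVec, Matrix.dotProduct_mulVec, Matrix.vecMul_transpose]
  have hg : ∀ x, gaussianDensity m T x =
      c * Real.exp (-(1/2) * ((M *ᵥ fun i => x i - m i) ⬝ᵥ (M *ᵥ fun i => x i - m i))) := by
    intro x
    rw [gaussianDensity, hq]
  have hpos : ∀ x, 0 < gaussianDensity m T x := by
    intro x; rw [hg]; positivity
  obtain ⟨i1, v1⟩ := aux_cov M hM m (fun x => Real.exp (-(1/2) * (x ⬝ᵥ x)))
    (by simp only [dotProduct]; fun_prop) (aux_int3 d)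
  obtain ⟨i2, v2⟩ := aux_cov M hM m (fun x => (x ⬝ᵥ x) * Real.exp (-(1/2) * (x ⬝ᵥ x)))
    (by simp only [dotProduct]; fun_prop) (aux_int5 d)
  rw [aux_val3, hdM] at v1
  rw [aux_val5, hdM] at v2
  have hgl : ∀ x, gaussianDensity m T x * Real.log (gaussianDensity m T x) =
      (c * Real.log c) *
        Real.exp (-(1/2) * ((M *ᵥ fun i => x i - m i) ⬝ᵥ (M *ᵥ fun i => x i - m i)))
      + (-(1/2) * c) * (((M *ᵥ fun i => x i - m i) ⬝ᵥ (M *ᵥ fun i => x i - m i)) *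
        Real.exp (-(1/2) * ((M *ᵥ fun i => x i - m i) ⬝ᵥ (M *ᵥ fun i => x i - m i)))) := by
    intro x
    rw [hg, Real.log_mul hcpos.ne' (Real.exp_pos _).ne', Real.log_exp]
    ring
  refine ⟨?_, ?_, ?_, ?_, hpos, ?_⟩
  · rw [funext hg]; exact i1.const_mul c
  · rw [funext hg, integral_const_mul, v1, hcc]
  · rw [funext hgl]; exact (i1.const_mul _).add (i2.const_mul _)
  · rw [funext hgl, integral_add (i1.const_mul _) (i2.const_mul _), integral_const_mul,
      integral_const_mul, v1, v2]
    have hlc : Real.log c = -(1/2) * Real.log ((2 * π) ^ d * T.det) := by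
      rw [hc, Real.log_inv, Real.log_sqrt (by positivity)]; ring
    have hle : Real.log ((2 * π * Real.exp 1) ^ d * T.det)
        = d + Real.log ((2 * π) ^ d * T.det) := by
      rw [mul_pow, mul_right_comm, Real.log_mul (by positivity) (by positivity), Real.log_pow,
        Real.log_exp]; ring
    rw [hle]
    linear_combination (Real.log c - (1/2) * d) * hcc + hlc
  · intro x
    rw [hg]
    apply mul_le_of_le_one_right hcpos.le
    rw [Real.exp_le_one_iff]
    have : 0 ≤ (M *ᵥ fun i => x i - m i) ⬝ᵥ (M *ᵥ fun i => x i - m i) :=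
      Finset.sum_nonneg (fun i _ => mul_self_nonneg _)
    linarith

/-- With `Ẑ ~ ∑ π_i N(μ_i, Σ_i)`, `ε ~ N(0, Σ_p)` independent (`Σ_p ≻ 0`)
and `Z = Ẑ + ε`, the mutual information `I(Z;Ẑ) = H(Z) - H(Z|Ẑ)`, where
`Z ~ ∑ π_i N(μ_i, Σ_i + Σ_p)` and `H(Z|Ẑ) = H(ε) = (1/2) log((2πe)^d det Σ_p)`, satisfies
`I(Z;Ẑ) ≤ ∑ π_i ( -log π_i + (1/2) log( det(Σ_i + Σ_p)/det Σ_p ) )`. -/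
theorem mutual_info_upper_bound {d k : ℕ}
    (w : Fin k → ℝ) (μ : Fin k → EuclideanSpace ℝ (Fin d))
    (S : Fin k → Matrix (Fin d) (Fin d) ℝ) (Sp : Matrix (Fin d) (Fin d) ℝ)
    (hw : ∀ i, 0 < w i) (hsum : ∑ i, w i = 1)
    (hS : ∀ i, (S i).PosSemidef) (hSp : Sp.PosDef) :
    diffEntropy (fun z => ∑ i, w i * gaussianDensity (μ i) (S i + Sp) z)
        - (1 / 2) * Real.log ((2 * π * Real.exp 1) ^ d * Sp.det)
      ≤ ∑ i, w i * (-Real.log (w i)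
          + (1 / 2) * Real.log ((S i + Sp).det / Sp.det)) := by
  have hT : ∀ i, (S i + Sp).PosDef := fun i => hSp.posSemidef_add (hS i)
  have H := fun i => aux_main (μ i) (S i + Sp) (hT i)
  choose I V IL VL P B using H
  set g : Fin k → EuclideanSpace ℝ (Fin d) → ℝ := fun i => gaussianDensity (μ i) (S i + Sp) with hgdef
  have hk : (Finset.univ : Finset (Fin k)).Nonempty := by
    by_contra h
    rw [Finset.not_nonempty_iff_eq_empty] at h
    rw [h] at hsum
    simp at hsum
  set p : EuclideanSpace ℝ (Fin d) → ℝ := fun z => ∑ i, w i * g i z with hp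
  have hpi : Integrable p := integrable_finsetSum _ (fun i _ => (I i).const_mul _)
  have hppos : ∀ z, 0 < p z := fun z => Finset.sum_pos (fun i _ => mul_pos (hw i) (P i z)) hk
  have hge : ∀ i z, w i * g i z ≤ p z := fun i z =>
    Finset.single_le_sum (f := fun i => w i * g i z)
      (fun j _ => (mul_pos (hw j) (P j z)).le) (Finset.mem_univ i)
  set L : EuclideanSpace ℝ (Fin d) → ℝ := fun z =>
    ∑ i, (w i * Real.log (w i) * g i z + w i * (g i z * Real.log (g i z))) with hL
  have hLi' : ∀ i, Integrable (fun z =>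
      w i * Real.log (w i) * g i z + w i * (g i z * Real.log (g i z))) :=
    fun i => ((I i).const_mul _).add ((IL i).const_mul _)
  have hLi : Integrable L := integrable_finsetSum _ (fun i _ => hLi' i)
  have hlow : ∀ z, L z ≤ p z * Real.log (p z) := by
    intro z
    simp only [hL]
    conv_rhs => rw [hp]; rw [Finset.sum_mul]
    apply Finset.sum_le_sum
    intro i _
    have h1 : Real.log (w i * g i z) ≤ Real.log (p z) :=
      Real.log_le_log (mul_pos (hw i) (P i z)) (hge i z)
    rw [Real.log_mul (hw i).ne' (P i z).ne'] at h1
    have := mul_le_mul_of_nonneg_left h1 (mul_pos (hw i) (P i z)).le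
    calc _ = w i * g i z * (Real.log (w i) + Real.log (g i z)) := by ring
      _ ≤ _ := this
  set C : ℝ := ∑ i, w i * (Real.sqrt ((2 * π) ^ d * (S i + Sp).det))⁻¹ with hC
  have hup : ∀ z, p z * Real.log (p z) ≤ Real.log C * p z := by
    intro z
    rw [mul_comm]
    apply mul_le_mul_of_nonneg_right _ (hppos z).le
    apply Real.log_le_log (hppos z)
    exact Finset.sum_le_sum (fun i _ => mul_le_mul_of_nonneg_left (B i z) (hw i).le)
  have hpl : Integrable (fun z => p z * Real.log (p z)) := by
    refine integrable_of_le_of_le ?_ (Filter.Eventually.of_forall hlow)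
      (Filter.Eventually.of_forall hup) hLi (hpi.const_mul _)
    exact (hpi.aemeasurable.mul (Real.measurable_log.comp_aemeasurable
      hpi.aemeasurable)).aestronglyMeasurable
  have hmain := integral_mono hLi hpl hlow
  have hLv : ∫ z, L z = ∑ i, (w i * Real.log (w i)
      + w i * -((1/2) * Real.log ((2 * π * Real.exp 1) ^ d * (S i + Sp).det))) := by
    rw [hL, integral_finsetSum _ (fun i _ => hLi' i)]
    refine Finset.sum_congr rfl (fun i _ => ?_)
    rw [integral_add ((I i).const_mul _) ((IL i).const_mul _), integral_const_mul,
      integral_const_mul, V, VL, mul_one]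
  rw [hLv] at hmain
  have hR : ∑ i, w i * (-Real.log (w i) + (1 / 2) * Real.log ((S i + Sp).det / Sp.det))
      = -(∑ i, (w i * Real.log (w i)
      + w i * -((1/2) * Real.log ((2 * π * Real.exp 1) ^ d * (S i + Sp).det))))
      - (1 / 2) * Real.log ((2 * π * Real.exp 1) ^ d * Sp.det) := by
    rw [← mul_one ((1 / 2) * Real.log ((2 * π * Real.exp 1) ^ d * Sp.det)), ← hsum,
      Finset.mul_sum, ← Finset.sum_neg_distrib, ← Finset.sum_sub_distrib]
    refine Finset.sum_congr rfl (fun i _ => ?_)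
    have h1 := (hT i).det_pos
    have h2 := hSp.det_pos
    rw [Real.log_div h1.ne' h2.ne', Real.log_mul (by positivity) h1.ne',
      Real.log_mul (by positivity) h2.ne']
    ring
  rw [hR]
  have : diffEntropy p = -∫ z, p z * Real.log (p z) := rfl
  change diffEntropy p - _ ≤ _
  rw [this]
  linarith
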